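/- For every d ≥ 3 one has δ_2(e_d) = 0, and for every d ≥ 4 there exists g ∈ K_3^{(d+1)} with δ_3(g) = e_d (so every e_d with d ≥ 4 lies in δ_3(K_3)). -/

import Mathlib

open Finset

/-- A list `[m_1, …, m_n]` of natural numbers is an Anick chain if it is nonempty,
`m_j ≥ 2` for all `1 ≤ j ≤ n-2`, and (when `n ≥ 2`) either `m_{n-1} ≥ 2` or
`(m_{n-1}, m_n) = (1, 0)`. -/
def AnickChain (l : List ℕ) : Prop :=
  l ≠ [] ∧ (∀ j, j + 2 < l.length → 2 ≤ l.getD j 0) ∧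
    (2 ≤ l.length →
      2 ≤ l.getD (l.length - 2) 0 ∨
        (l.getD (l.length - 2) 0 = 1 ∧ l.getD (l.length - 1) 0 = 0))

/-- The ℚ-vector space with basis the set of all Anick chains (of all lengths);
its length-homogeneous components are the spaces `A_n`. -/
abbrev AnickSpace : Type := {l : List ℕ // AnickChain l} →₀ ℚ

open Classical in
/-- The basis element `[m_1|…|m_n]` attached to a list; by convention it is `0`
if the list is not an Anick chain. -/
noncomputable def br (l : List ℕ) : AnickSpace :=
  if h : AnickChain l then Finsupp.single ⟨l, h⟩ 1 else 0

/-- The `j`-th entry of a list, `1`-based (with default value 0). -/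
def ent (l : List ℕ) (j : ℕ) : ℕ := l.getD (j - 1) 0

/-- Replace the pair of entries at (1-based) positions `j, j+1` by the single entry `c`. -/
def mergeAt (l : List ℕ) (j c : ℕ) : List ℕ := l.take (j - 1) ++ c :: l.drop (j + 1)

/-- Decrease the (1-based) `t`-th entry by one. -/
def decAt (l : List ℕ) (t : ℕ) : List ℕ := l.set (t - 1) (ent l t - 1)

open Classical in
/-- The value of the Anick differential on the basis chain `[i_1|…|i_{n+1}]`. -/
noncomputable def deltaFun (l : List ℕ) : AnickSpace :=
  let n := l.length - 1
  let i : ℕ → ℚ := fun j => (ent l j : ℚ)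
  if 2 ≤ ent l n then
    (∑ j ∈ Icc 1 n, ((-1 : ℚ) ^ j * (i j * (i j - 1) / (i j + i (j + 1) - 1))) •
        br (mergeAt l j (ent l j + ent l (j + 1) - 1)))
    + (∑ j ∈ Icc 2 n, ∑ t ∈ Icc 1 (j - 1),
        ((-1 : ℚ) ^ j * (i t * (i j - 1) * (i (j + 1) - 1) / (i j + i (j + 1) - 1))) •
          br (mergeAt (decAt l t) j (ent l j + ent l (j + 1))))
    + (∑ j ∈ Icc 2 n, ∑ t ∈ Icc 1 (j - 1),
        ((-1 : ℚ) ^ j * (i j * i (j + 1) * (i t - 1) / (i j + i (j + 1) - 1))) •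
          br (mergeAt l j (ent l j + ent l (j + 1) - 1)))
  else if ent l n = 1 ∧ ent l (n + 1) = 0 then
    (∑ j ∈ Icc 1 (n - 2), ((-1 : ℚ) ^ j * (i j * (i j - 1) / (i j + i (j + 1) - 1))) •
        br (mergeAt l j (ent l j + ent l (j + 1) - 1)))
    + (∑ j ∈ Icc 2 (n - 2), ∑ t ∈ Icc 1 (j - 1),
        ((-1 : ℚ) ^ j * (i t * (i j - 1) * (i (j + 1) - 1) / (i j + i (j + 1) - 1))) •
          br (mergeAt (decAt l t) j (ent l j + ent l (j + 1))))
    + (∑ j ∈ Icc 2 (n - 2), ∑ t ∈ Icc 1 (j - 1),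
        ((-1 : ℚ) ^ j * (i j * i (j + 1) * (i t - 1) / (i j + i (j + 1) - 1))) •
          br (mergeAt l j (ent l j + ent l (j + 1) - 1)))
    + (∑ j ∈ Icc 1 (n - 1), ((-1 : ℚ) ^ n * i j) • br ((decAt l j).dropLast))
    + (∑ j ∈ Icc 1 (n - 1), ((-1 : ℚ) ^ (n - 1) * (i j - 1)) • br (l.take (n - 1) ++ [0]))
    + ((-1 : ℚ) ^ n • br (l.take (n - 1) ++ [0]))
  else 0

/-- The Anick differential `δ` (the direct sum of all the maps `δ_n`; on the
length-one component it vanishes, i.e. `δ_1 = 0`). -/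
noncomputable def anickDelta : AnickSpace →ₗ[ℚ] AnickSpace :=
  Finsupp.linearCombination ℚ (fun c => deltaFun c.1)

/-- The value of `∂̃` on a basis chain. -/
noncomputable def dtilFun (l : List ℕ) : AnickSpace :=
  ∑ j ∈ Finset.range l.length, (l.getD j 0 : ℚ) • br (l.set j (l.getD j 0 - 1))

/-- The derivation `∂̃` on the Anick complex. -/
noncomputable def dtil : AnickSpace →ₗ[ℚ] AnickSpace :=
  Finsupp.linearCombination ℚ (fun c => dtilFun c.1)

/-- `A_n`: the span of the Anick chains of length `n`. -/
noncomputable def A (n : ℕ) : Submodule ℚ AnickSpace :=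
  Finsupp.supported ℚ ℚ {c | c.1.length = n}

/-- `A_{n,k}`: the span of the Anick chains of length `n` whose last entry is `≥ k`. -/
noncomputable def Ak (n k : ℕ) : Submodule ℚ AnickSpace :=
  Finsupp.supported ℚ ℚ {c | c.1.length = n ∧ k ≤ c.1.getD (n - 1) 0}

/-- `A_n^{(d)}`: the span of the Anick chains of length `n` and degree `d`. -/
noncomputable def Adeg (n d : ℕ) : Submodule ℚ AnickSpace :=
  Finsupp.supported ℚ ℚ {c | c.1.length = n ∧ c.1.sum = d}

/-- `A_n^{(d)∘}`: the span of the regular Anick chains (all entries `≥ 2`) of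
length `n` and degree `d`. -/
noncomputable def Areg (n d : ℕ) : Submodule ℚ AnickSpace :=
  Finsupp.supported ℚ ℚ {c | c.1.length = n ∧ c.1.sum = d ∧ ∀ j < n, 2 ≤ c.1.getD j 0}

/-- `K_n = ker ∂̃_n ⊆ A_n`. -/
noncomputable def K (n : ℕ) : Submodule ℚ AnickSpace := A n ⊓ LinearMap.ker dtil

/-- `K_n^{(d)} = K_n ∩ A_n^{(d)}`. -/
noncomputable def Kdeg (n d : ℕ) : Submodule ℚ AnickSpace := K n ⊓ Adeg n d

open Classical in
/-- The component map `a ↦ a_i`: keep only the chains whose last entry is `i`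
and delete that last entry. -/
noncomputable def component (i : ℕ) : AnickSpace →ₗ[ℚ] AnickSpace :=
  Finsupp.linearCombination ℚ
    (fun c => if c.1.getLast? = some i then br c.1.dropLast else 0)

/-- The elements `e_1 = [1|0]` and `e_d = Σ_{s=0}^{d-2} (-1)^s C(d,s) [d-s|s]` for `d ≥ 3`. -/
noncomputable def eElt (d : ℕ) : AnickSpace :=
  if d = 1 then br [1, 0]
  else ∑ s ∈ Finset.range (d - 1), ((-1 : ℚ) ^ s * (d.choose s : ℚ)) • br [d - s, s]

lemma br_eq_single {l : List ℕ} (h : AnickChain l) : br l = Finsupp.single ⟨l, h⟩ 1 := by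
  simp [br, h]

lemma br_eq_zero {l : List ℕ} (h : ¬ AnickChain l) : br l = 0 := by
  simp [br, h]

lemma anickChain_pair {a b : ℕ} : AnickChain [a, b] ↔ 2 ≤ a ∨ (a = 1 ∧ b = 0) := by
  simp [AnickChain]

lemma anickChain_triple {a b c : ℕ} :
    AnickChain [a, b, c] ↔ 2 ≤ a ∧ (2 ≤ b ∨ (b = 1 ∧ c = 0)) := by
  simp only [AnickChain, ne_eq, reduceCtorEq, not_false_eq_true, true_and, List.length_cons,
    List.length_nil]
  constructor
  · rintro ⟨h, h'⟩
    exact ⟨by simpa using h 0 (by norm_num), by simpa using h'⟩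
  · rintro ⟨h, h'⟩
    refine ⟨fun j hj => ?_, fun _ => by simpa using h'⟩
    obtain rfl : j = 0 := by omega
    simpa using h

lemma anickDelta_br {l : List ℕ} (h : AnickChain l) : anickDelta (br l) = deltaFun l := by
  simp [br_eq_single h, anickDelta]

lemma dtil_br {l : List ℕ} (h : AnickChain l) : dtil (br l) = dtilFun l := by
  simp [br_eq_single h, dtil]

lemma anickDelta_br_pair {a b : ℕ} (ha : 2 ≤ a) :
    anickDelta (br [a, b]) =
      (-((a : ℚ) * (a - 1) / (a + b - 1))) • br [a + b - 1] := by
  rw [anickDelta_br (anickChain_pair.2 (Or.inl ha))]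
  simp [deltaFun, ent, mergeAt, ha]

lemma anickDelta_br_triple {a b c : ℕ} (ha : 2 ≤ a) (hb : 2 ≤ b) :
    anickDelta (br [a, b, c]) =
      (-((a : ℚ) * (a - 1) / (a + b - 1))) • br [a + b - 1, c]
      + ((b : ℚ) * (b - 1) / (b + c - 1) + b * c * (a - 1) / (b + c - 1)) • br [a, b + c - 1]
      + ((a : ℚ) * (b - 1) * (c - 1) / (b + c - 1)) • br [a - 1, b + c] := by
  rw [anickDelta_br (anickChain_triple.2 ⟨ha, Or.inl hb⟩)]
  have h12 : Icc 1 2 = ({1, 2} : Finset ℕ) := rfl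
  simp only [deltaFun, ent, mergeAt, decAt, List.length_cons, List.length_nil]
  simp [hb, h12]
  module

lemma dtil_br_triple {a b c : ℕ} (ha : 2 ≤ a) (hb : 2 ≤ b) :
    dtil (br [a, b, c]) =
      (a : ℚ) • br [a - 1, b, c] + (b : ℚ) • br [a, b - 1, c] + (c : ℚ) • br [a, b, c - 1] := by
  rw [dtil_br (anickChain_triple.2 ⟨ha, Or.inl hb⟩)]
  simp [dtilFun, Finset.sum_range_succ]

lemma br_mem_Adeg {l : List ℕ} (h : AnickChain l) : br l ∈ Adeg l.length l.sum := by
  rw [br_eq_single h]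
  exact Finsupp.single_mem_supported ℚ 1 ⟨rfl, rfl⟩

lemma Adeg_le_A (n d : ℕ) : Adeg n d ≤ A n :=
  Finsupp.supported_mono fun _ h => h.1

lemma alternating_sum_choose_succ (n : ℕ) :
    ∑ s ∈ range (n + 2), (-1 : ℚ) ^ s * ((n + 1).choose s : ℚ) = 0 := by
  have h := Int.alternating_sum_range_choose (n := n + 1)
  simp only [Nat.add_eq_zero_iff, one_ne_zero, and_false, if_false] at h
  exact_mod_cast h

lemma choose_succ_mul_sub {n s : ℕ} (h : s ≤ n + 1) :
    ((n + 1).choose s : ℚ) * ((n : ℚ) + 1 - s) = (n + 1) * (n.choose s : ℚ) := by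
  have h1 := Nat.choose_mul_succ_eq n s
  rw [← Nat.cast_inj (R := ℚ)] at h1
  push_cast [Nat.cast_sub h] at h1
  linarith

lemma anickDelta_eElt (m : ℕ) : anickDelta (eElt (m + 3)) = 0 := by
  have key : ∀ s ∈ range (m + 2),
      anickDelta (((-1 : ℚ) ^ s * ((m + 3).choose s : ℚ)) • br [m + 3 - s, s]) =
        ((-1 : ℚ) ^ s * ((m + 1).choose s : ℚ)) • ((-(m + 3) : ℚ) • br [m + 2]) := by
    intro s hs
    have hs : s < m + 2 := mem_range.1 hs
    rw [map_smul, anickDelta_br_pair (by omega), show m + 3 - s + s - 1 = m + 2 by omega,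
      smul_smul, smul_smul]
    congr 1
    have h1 := choose_succ_mul_sub (n := m + 2) (s := s) (by omega)
    have h2 := choose_succ_mul_sub (n := m + 1) (s := s) (by omega)
    rw [Nat.cast_sub (by omega)]
    push_cast at h1 h2 ⊢
    have h0 : (m : ℚ) + 2 ≠ 0 := by positivity
    rw [show (m : ℚ) + 3 - s + s - 1 = m + 2 by ring]
    field_simp
    linear_combination (-(m + 2 - s : ℚ)) * h1 - (m + 3 : ℚ) * h2
  rw [eElt, if_neg (by omega), map_sum, show m + 3 - 1 = m + 2 by omega, sum_congr rfl key,
    ← sum_smul, alternating_sum_choose_succ, zero_smul]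

/-- The chain part of `(x - y)^2 (y - z)^(k+3)` under `x^a y^b z^c ↔ [a|b|c]`. -/
noncomputable def quadraticCycle (k : ℕ) : AnickSpace :=
  ∑ c ∈ range (k + 2), ((-1 : ℚ) ^ c * ((k + 3).choose c : ℚ)) • br [2, k + 3 - c, c]

lemma quadraticCycle_mem_Adeg (k : ℕ) : quadraticCycle k ∈ Adeg 3 (k + 5) := by
  refine Submodule.sum_mem _ fun c hc => Submodule.smul_mem _ _ ?_
  have hc : c < k + 2 := mem_range.1 hc
  have h := br_mem_Adeg (l := [2, k + 3 - c, c])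
    (anickChain_triple.2 ⟨le_rfl, Or.inl (by omega)⟩)
  have hsum : [2, k + 3 - c, c].sum = k + 5 := by
    simp only [List.sum_cons, List.sum_nil]
    omega
  rw [hsum] at h
  exact h

lemma dtil_quadraticCycle (k : ℕ) : dtil (quadraticCycle k) = 0 := by
  let F : ℕ → AnickSpace := fun c =>
    ((-1 : ℚ) ^ c * ((k + 3).choose c : ℚ) * c) • br [2, k + 3 - c, c - 1]
  have key : ∀ c ∈ range (k + 2),
      dtil (((-1 : ℚ) ^ c * ((k + 3).choose c : ℚ)) • br [2, k + 3 - c, c]) =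
        F c - F (c + 1) := by
    intro c hc
    have hc : c < k + 2 := mem_range.1 hc
    have h := Nat.choose_succ_right_eq (k + 3) c
    rw [← Nat.cast_inj (R := ℚ)] at h
    rw [map_smul, dtil_br_triple le_rfl (by omega),
      br_eq_zero (l := [2 - 1, k + 3 - c, c]) (by simp [anickChain_triple])]
    simp only [F, Nat.add_sub_cancel, show k + 3 - (c + 1) = k + 3 - c - 1 by omega]
    have e : (-1 : ℚ) ^ (c + 1) * ((k + 3).choose (c + 1) : ℚ) * ((c + 1 : ℕ) : ℚ) =
        -((-1 : ℚ) ^ c * ((k + 3).choose c : ℚ) * ((k + 3 - c : ℕ) : ℚ)) := by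
      push_cast at h ⊢
      rw [pow_succ]
      linear_combination (-(-1 : ℚ) ^ c) * h
    rw [e]
    module
  rw [quadraticCycle, map_sum, sum_congr rfl key, sum_range_sub']
  simp only [F]
  rw [br_eq_zero (l := [2, k + 3 - (k + 2), k + 2 - 1]) (by
    rw [anickChain_triple]; omega)]
  simp

lemma anickDelta_quadraticCycle (k : ℕ) :
    anickDelta (quadraticCycle k) = (-2 / (k + 4) : ℚ) • eElt (k + 4) := by
  have key : ∀ c ∈ range (k + 2),
      anickDelta (((-1 : ℚ) ^ c * ((k + 3).choose c : ℚ)) • br [2, k + 3 - c, c]) =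
        (-2 / (k + 4) : ℚ) • (((-1 : ℚ) ^ c * ((k + 4).choose c : ℚ)) • br [k + 4 - c, c])
        + ((-1 : ℚ) ^ c * ((k + 2).choose c : ℚ)) • ((k + 3 : ℚ) • br [2, k + 2]) := by
    intro c hc
    have hc : c < k + 2 := mem_range.1 hc
    have h1 := choose_succ_mul_sub (n := k + 3) (s := c) (by omega)
    have h2 := choose_succ_mul_sub (n := k + 2) (s := c) (by omega)
    rw [map_smul, anickDelta_br_triple le_rfl (by omega),
      br_eq_zero (l := [2 - 1, k + 3 - c + c]) (by rw [anickChain_pair]; omega),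
      show 2 + (k + 3 - c) - 1 = k + 4 - c by omega,
      show k + 3 - c + c - 1 = k + 2 by omega, smul_zero, add_zero, smul_add, smul_smul,
      smul_smul, smul_smul, smul_smul]
    have hck : (c : ℚ) < k + 2 := by exact_mod_cast hc
    have hp : (k : ℚ) + 4 - c ≠ 0 := by linarith
    rw [Nat.cast_sub (by omega)]
    push_cast at h1 h2 ⊢
    congr 2
    · rw [show (2 : ℚ) + (k + 3 - c) - 1 = k + 4 - c by ring]
      field_simp
      linear_combination h1
    · rw [show (k : ℚ) + 3 - c + c - 1 = k + 2 by ring]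
      have h0 : (k : ℚ) + 2 ≠ 0 := by positivity
      field_simp
      linear_combination (k + 2 : ℚ) * h2
  have hs : ∑ c ∈ range (k + 2), (-1 : ℚ) ^ c * ((k + 2).choose c : ℚ) = -(-1) ^ (k + 2) := by
    have h := alternating_sum_choose_succ (k + 1)
    rw [sum_range_succ] at h
    simp only [Nat.choose_self, Nat.cast_one, mul_one, add_assoc, Nat.reduceAdd] at h
    linarith
  have hch : ((k + 4).choose (k + 2) : ℚ) = (k + 4) * (k + 3) / 2 := by
    rw [Nat.choose_symm_of_eq_add (show k + 4 = (k + 2) + 2 by ring), Nat.cast_choose_two]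
    push_cast
    ring
  rw [quadraticCycle, map_sum, sum_congr rfl key, sum_add_distrib, ← sum_smul, hs, eElt,
    if_neg (by omega), show k + 4 - 1 = k + 2 + 1 by omega, sum_range_succ _ (k + 2), smul_add,
    ← smul_sum, hch, show k + 4 - (k + 2) = 2 by omega, smul_smul, smul_smul]
  congr 2
  field_simp

/-- `δ_2(e_d) = 0` for all `d ≥ 3`, and for every `d ≥ 4` there is
`g ∈ K_3^{(d+1)}` with `δ_3(g) = e_d`. -/
theorem eElt_cycles_and_boundaries :
    (∀ d : ℕ, 3 ≤ d → anickDelta (eElt d) = 0) ∧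
    (∀ d : ℕ, 4 ≤ d → ∃ g ∈ Kdeg 3 (d + 1), anickDelta g = eElt d) := by
  refine ⟨fun d hd => ?_, fun d hd => ?_⟩
  · obtain ⟨m, rfl⟩ := Nat.exists_eq_add_of_le' hd
    exact anickDelta_eElt m
  · obtain ⟨k, rfl⟩ := Nat.exists_eq_add_of_le' hd
    have hmem := quadraticCycle_mem_Adeg k
    refine ⟨(-(k + 4) / 2 : ℚ) • quadraticCycle k, Submodule.smul_mem _ _
      ⟨⟨Adeg_le_A _ _ hmem, LinearMap.mem_ker.2 (dtil_quadraticCycle k)⟩, hmem⟩, ?_⟩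
    have h0 : (k : ℚ) + 4 ≠ 0 := by positivity
    rw [map_smul, anickDelta_quadraticCycle, smul_smul,
      show (-(k + 4) / 2 : ℚ) * (-2 / (k + 4)) = 1 by field_simp, one_smul]
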